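/- arXiv:1206.4395 — 4 statements merged into one kernel-verified Lean document; each statement's English description precedes it below -/
import Mathlib

section
/- Consider the polynomial ring ℂ[y₁,x₁,y₂,x₂,y₃,x₃,h₁,h₂] with the action of the two-dimensional torus (ℂ*)² given, for (t₁,t₂) ∈ (ℂ*)², by the algebra substitution y₁ ↦ t₁⁻²t₂·y₁, x₁ ↦ t₁²t₂⁻¹·x₁, y₂ ↦ t₁t₂⁻²·y₂, x₂ ↦ t₁⁻¹t₂²·x₂, y₃ ↦ t₁⁻¹t₂⁻¹·y₃, x₃ ↦ t₁t₂·x₃, h₁ ↦ h₁, h₂ ↦ h₂. Then a polynomial P is fixed by this substitution for all (t₁,t₂) ∈ (ℂ*)² if and only if P lies in the ℂ-subalgebra generated by the seven monomials h₁, h₂, x₁y₁, x₂y₂, x₃y₃, x₁x₂y₃, x₃y₁y₂. (These seven monomials form a Hilbert basis of the invariant ring of the maximal torus of SL(3) acting on sl(3).) -/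
open MvPolynomial

/-- Variables: `0 ↦ y₁, 1 ↦ x₁, 2 ↦ y₂, 3 ↦ x₂, 4 ↦ y₃, 5 ↦ x₃, 6 ↦ h₁, 7 ↦ h₂`. -/
noncomputable abbrev y₁ : MvPolynomial (Fin 8) ℂ := X 0
noncomputable abbrev x₁ : MvPolynomial (Fin 8) ℂ := X 1
noncomputable abbrev y₂ : MvPolynomial (Fin 8) ℂ := X 2
noncomputable abbrev x₂ : MvPolynomial (Fin 8) ℂ := X 3
noncomputable abbrev y₃ : MvPolynomial (Fin 8) ℂ := X 4
noncomputable abbrev x₃ : MvPolynomial (Fin 8) ℂ := X 5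
noncomputable abbrev h₁ : MvPolynomial (Fin 8) ℂ := X 6
noncomputable abbrev h₂ : MvPolynomial (Fin 8) ℂ := X 7

/-- The weight factors of the maximal torus of `SL(3)` acting on `sl(3)`
in the Cartan–Weyl coordinates. -/
noncomputable def torusWeight (t₁ t₂ : ℂ) : Fin 8 → ℂ :=
  ![t₁⁻¹ ^ 2 * t₂, t₁ ^ 2 * t₂⁻¹, t₁ * t₂⁻¹ ^ 2, t₁⁻¹ * t₂ ^ 2,
    t₁⁻¹ * t₂⁻¹, t₁ * t₂, 1, 1]

/-- The substitution action of `(t₁,t₂) ∈ (ℂ*)²` on the polynomial ring. -/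
noncomputable def torusAct (t₁ t₂ : ℂ) :
    MvPolynomial (Fin 8) ℂ →ₐ[ℂ] MvPolynomial (Fin 8) ℂ :=
  aeval fun i => C (torusWeight t₁ t₂ i) * X i

theorem coeff_torusAct (t₁ t₂ : ℂ) (P : MvPolynomial (Fin 8) ℂ) (m : Fin 8 →₀ ℕ) :
    coeff m (torusAct t₁ t₂ P) = (∏ i, torusWeight t₁ t₂ i ^ m i) * coeff m P := by
  induction P using MvPolynomial.induction_on' with
  | add p q hp hq => rw [map_add, coeff_add, coeff_add, hp, hq, mul_add]
  | monomial u a =>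
    have h : torusAct t₁ t₂ (monomial u a) =
        C (∏ i, torusWeight t₁ t₂ i ^ u i) * monomial u a := by
      rw [torusAct, aeval_monomial, Finsupp.prod_fintype _ _ (fun _ => pow_zero _),
        monomial_eq, Finsupp.prod_fintype _ _ (fun _ => pow_zero _)]
      simp only [mul_pow, Finset.prod_mul_distrib, map_prod, map_pow, algebraMap_eq]
      ring
    rw [h, coeff_C_mul, coeff_monomial]
    split_ifs with hu
    · rw [hu]
    · simp

/-- An exponent vector of total weight zero differs from a sum of root pairs by a multiple of
`x₁x₂y₃` or of `x₃y₁y₂`. -/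
theorem exists_exponents_of_weight_eq_zero {m : Fin 8 →₀ ℕ}
    (h₁ : 2 * m 1 + m 2 + m 5 = 2 * m 0 + m 3 + m 4)
    (h₂ : m 0 + 2 * m 3 + m 5 = m 1 + 2 * m 2 + m 4) :
    (∃ k, m 1 = m 0 + k ∧ m 3 = m 2 + k ∧ m 4 = m 5 + k) ∨
      ∃ k, m 0 = m 1 + k ∧ m 2 = m 3 + k ∧ m 5 = m 4 + k := by
  rcases le_total (m 0) (m 1) with h | h
  · exact Or.inl ⟨m 1 - m 0, by omega, by omega, by omega⟩
  · exact Or.inr ⟨m 0 - m 1, by omega, by omega, by omega⟩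

theorem monomial_mem_adjoin_of_weight_eq_zero {m : Fin 8 →₀ ℕ} (c : ℂ)
    (hm₁ : 2 * m 1 + m 2 + m 5 = 2 * m 0 + m 3 + m 4)
    (hm₂ : m 0 + 2 * m 3 + m 5 = m 1 + 2 * m 2 + m 4) :
    monomial m c ∈ Algebra.adjoin ℂ
      ({h₁, h₂, x₁ * y₁, x₂ * y₂, x₃ * y₃, x₁ * x₂ * y₃, x₃ * y₁ * y₂} :
        Set (MvPolynomial (Fin 8) ℂ)) := by
  set S := Algebra.adjoin ℂ
    ({h₁, h₂, x₁ * y₁, x₂ * y₂, x₃ * y₃, x₁ * x₂ * y₃, x₃ * y₁ * y₂} :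
      Set (MvPolynomial (Fin 8) ℂ))
  have hh₁ : h₁ ∈ S := Algebra.subset_adjoin (by simp)
  have hh₂ : h₂ ∈ S := Algebra.subset_adjoin (by simp)
  have hr₁ : x₁ * y₁ ∈ S := Algebra.subset_adjoin (by simp)
  have hr₂ : x₂ * y₂ ∈ S := Algebra.subset_adjoin (by simp)
  have hr₃ : x₃ * y₃ ∈ S := Algebra.subset_adjoin (by simp)
  have hu : x₁ * x₂ * y₃ ∈ S := Algebra.subset_adjoin (by simp)
  have hv : x₃ * y₁ * y₂ ∈ S := Algebra.subset_adjoin (by simp)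
  have hc : C c ∈ S := S.algebraMap_mem c
  rw [monomial_eq, Finsupp.prod_fintype _ _ (fun _ => pow_zero _), Fin.prod_univ_eight]
  rcases exists_exponents_of_weight_eq_zero hm₁ hm₂ with ⟨k, e₁, e₂, e₃⟩ | ⟨k, e₁, e₂, e₃⟩
  · have key := mul_mem hc (mul_mem (mul_mem (mul_mem (pow_mem hh₁ (m 6)) (pow_mem hh₂ (m 7)))
      (mul_mem (pow_mem hr₁ (m 0)) (pow_mem hr₂ (m 2))))
      (mul_mem (pow_mem hr₃ (m 5)) (pow_mem hu k)))
    convert key using 1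
    rw [e₁, e₂, e₃]
    ring
  · have key := mul_mem hc (mul_mem (mul_mem (mul_mem (pow_mem hh₁ (m 6)) (pow_mem hh₂ (m 7)))
      (mul_mem (pow_mem hr₁ (m 1)) (pow_mem hr₂ (m 3))))
      (mul_mem (pow_mem hr₃ (m 4)) (pow_mem hv k)))
    convert key using 1
    rw [e₁, e₂, e₃]
    ring

theorem weight_eq_zero_of_prod_torusWeight_two_one (m : Fin 8 → ℕ)
    (h : ∏ i, torusWeight 2 1 i ^ m i = 1) :
    2 * m 1 + m 2 + m 5 = 2 * m 0 + m 3 + m 4 := by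
  simp only [Fin.prod_univ_eight, torusWeight, Matrix.cons_val, inv_one, one_pow, mul_one,
    inv_pow, ← pow_mul] at h
  field_simp at h
  have h' : (2 : ℕ) ^ (2 * m 1 + m 2 + m 5) = 2 ^ (2 * m 0 + m 3 + m 4) := by
    exact_mod_cast (by linear_combination h :
      (2 : ℂ) ^ (2 * m 1 + m 2 + m 5) = 2 ^ (2 * m 0 + m 3 + m 4))
  exact Nat.pow_right_injective le_rfl h'

theorem weight_eq_zero_of_prod_torusWeight_one_two (m : Fin 8 → ℕ)
    (h : ∏ i, torusWeight 1 2 i ^ m i = 1) :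
    m 0 + 2 * m 3 + m 5 = m 1 + 2 * m 2 + m 4 := by
  simp only [Fin.prod_univ_eight, torusWeight, Matrix.cons_val, inv_one, one_pow, mul_one, one_mul,
    inv_pow, ← pow_mul] at h
  field_simp at h
  have h' : (2 : ℕ) ^ (m 0 + 2 * m 3 + m 5) = 2 ^ (m 1 + 2 * m 2 + m 4) := by
    exact_mod_cast (by linear_combination h :
      (2 : ℂ) ^ (m 0 + 2 * m 3 + m 5) = 2 ^ (m 1 + 2 * m 2 + m 4))
  exact Nat.pow_right_injective le_rfl h'

/-- A polynomial is invariant under the maximal torus of `SL(3)` acting on `sl(3)` iff it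
lies in the subalgebra generated by the Hilbert basis
`h₁, h₂, x₁y₁, x₂y₂, x₃y₃, x₁x₂y₃, x₃y₁y₂`. -/
theorem torus_invariants_sl3 (P : MvPolynomial (Fin 8) ℂ) :
    (∀ t₁ t₂ : ℂ, t₁ ≠ 0 → t₂ ≠ 0 → torusAct t₁ t₂ P = P) ↔
      P ∈ Algebra.adjoin ℂ
        ({h₁, h₂, x₁ * y₁, x₂ * y₂, x₃ * y₃, x₁ * x₂ * y₃, x₃ * y₁ * y₂} :
          Set (MvPolynomial (Fin 8) ℂ)) := by
  constructor
  · intro h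
    rw [P.as_sum]
    refine sum_mem fun m hm => ?_
    have hweight (t₁ t₂ : ℂ) (ht₁ : t₁ ≠ 0) (ht₂ : t₂ ≠ 0) :
        ∏ i, torusWeight t₁ t₂ i ^ m i = 1 := by
      refine mul_right_cancel₀ (mem_support_iff.mp hm) ?_
      rw [← coeff_torusAct, h t₁ t₂ ht₁ ht₂, one_mul]
    exact monomial_mem_adjoin_of_weight_eq_zero _
      (weight_eq_zero_of_prod_torusWeight_two_one m (hweight 2 1 two_ne_zero one_ne_zero))
      (weight_eq_zero_of_prod_torusWeight_one_two m (hweight 1 2 one_ne_zero two_ne_zero))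
  · intro hP t₁ t₂ ht₁ ht₂
    suffices hle : Algebra.adjoin ℂ
        ({h₁, h₂, x₁ * y₁, x₂ * y₂, x₃ * y₃, x₁ * x₂ * y₃, x₃ * y₁ * y₂} :
          Set (MvPolynomial (Fin 8) ℂ)) ≤
        AlgHom.equalizer (torusAct t₁ t₂) (AlgHom.id ℂ (MvPolynomial (Fin 8) ℂ)) from hle hP
    have hC (t : ℂ) (ht : t ≠ 0) :
        (C t * C t⁻¹ : MvPolynomial (Fin 8) ℂ) = 1 := by
      rw [← C_mul, mul_inv_cancel₀ ht, C_1]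
    have hC₁ := hC t₁ ht₁
    have hC₂ := hC t₂ ht₂
    refine Algebra.adjoin_le ?_
    rintro p (rfl | rfl | rfl | rfl | rfl | rfl | rfl) <;>
      simp only [SetLike.mem_coe, AlgHom.mem_equalizer, AlgHom.coe_id, id_eq, torusAct, map_mul,
        aeval_X, torusWeight, Matrix.cons_val, map_pow, map_one, one_mul] <;>
      grind
end

section
/- For a traceless 3×3 complex matrix A, set x₁=A₂₁, y₁=A₁₂, x₂=A₃₂, y₂=A₂₃, x₃=A₃₁, y₃=A₁₃, h₁=A₁₁−A₂₂, h₂=A₂₂−A₃₃, and define 𝔠₃(A) = 27(x₁x₂y₃ + x₃y₁y₂) + 2h₁³ + 3h₁²h₂ − 3h₁h₂² − 2h₂³ + 9[x₁y₁(h₁+2h₂) − x₂y₂(2h₁+h₂) + x₃y₃(h₁−h₂)]. Then 𝔠₃ is invariant under the adjoint action of SL(3,ℂ): for every g ∈ SL(3,ℂ) and every traceless 3×3 complex matrix A, 𝔠₃(gAg⁻¹) = 𝔠₃(A). -/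
open Matrix

/-- The cubic Casimir invariant `𝔠₃` of a traceless `3×3` matrix, written in the
Cartan–Weyl coordinates `x₁=A₂₁, y₁=A₁₂, x₂=A₃₂, y₂=A₂₃, x₃=A₃₁, y₃=A₁₃,
h₁=A₁₁−A₂₂, h₂=A₂₂−A₃₃`. -/
def casimir3 (A : Matrix (Fin 3) (Fin 3) ℂ) : ℂ :=
  27 * (A 1 0 * A 2 1 * A 0 2 + A 2 0 * A 0 1 * A 1 2) +
    2 * (A 0 0 - A 1 1) ^ 3 + 3 * (A 0 0 - A 1 1) ^ 2 * (A 1 1 - A 2 2) -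
    3 * (A 0 0 - A 1 1) * (A 1 1 - A 2 2) ^ 2 - 2 * (A 1 1 - A 2 2) ^ 3 +
    9 * (A 1 0 * A 0 1 * ((A 0 0 - A 1 1) + 2 * (A 1 1 - A 2 2)) -
         A 2 1 * A 1 2 * (2 * (A 0 0 - A 1 1) + (A 1 1 - A 2 2)) +
         A 2 0 * A 0 2 * ((A 0 0 - A 1 1) - (A 1 1 - A 2 2)))

/-- On traceless matrices, `𝔠₃` is `27` times the determinant. -/
theorem casimir3_eq_det {A : Matrix (Fin 3) (Fin 3) ℂ} (hA : A.trace = 0) :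
    casimir3 A = 27 * A.det := by
  rw [Matrix.trace_fin_three] at hA
  have h : A 2 2 = -A 0 0 - A 1 1 := by linear_combination hA
  rw [casimir3, Matrix.det_fin_three, h]
  ring

/-- `𝔠₃` is invariant under the adjoint action of `SL(3,ℂ)` on `sl(3,ℂ)`. -/
theorem casimir3_adjoint_invariant (g : Matrix.SpecialLinearGroup (Fin 3) ℂ)
    (A : Matrix (Fin 3) (Fin 3) ℂ) (hA : A.trace = 0) :
    casimir3 ((g : Matrix (Fin 3) (Fin 3) ℂ) * A *
      ((g⁻¹ : Matrix.SpecialLinearGroup (Fin 3) ℂ) : Matrix (Fin 3) (Fin 3) ℂ)) = casimir3 A := by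
  have hg : ((g⁻¹ : Matrix.SpecialLinearGroup (Fin 3) ℂ) : Matrix (Fin 3) (Fin 3) ℂ) *
      (g : Matrix (Fin 3) (Fin 3) ℂ) = 1 := by
    rw [← Matrix.SpecialLinearGroup.coe_mul, inv_mul_cancel, Matrix.SpecialLinearGroup.coe_one]
  rw [casimir3_eq_det hA, casimir3_eq_det]
  · rw [Matrix.det_mul, Matrix.det_mul, Matrix.SpecialLinearGroup.det_coe,
      Matrix.SpecialLinearGroup.det_coe, one_mul, mul_one]
  · rw [Matrix.trace_mul_comm, ← Matrix.mul_assoc, hg, Matrix.one_mul, hA]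
end

section
/- For a traceless 3×3 complex matrix A, define I₄(A) = (A₁₁−A₂₂)A₂₃A₁₃ + A₁₂A₂₃² − A₂₁A₁₃². Then for every g ∈ SL(2,ℂ) and every traceless 3×3 complex matrix A, I₄(u(g)·A·u(g)⁻¹) = I₄(A), where u(g) ∈ SL(3,ℂ) is the block-diagonal matrix with upper-left 2×2 block g and lower-right entry 1. -/
open Matrix

/-- The embedding `g ↦ u(g) = diag(g,1)` of `SL(2,ℂ)` into the `3×3` matrices. -/
def u (g : Matrix.SpecialLinearGroup (Fin 2) ℂ) : Matrix (Fin 3) (Fin 3) ℂ :=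
  !![(g : Matrix (Fin 2) (Fin 2) ℂ) 0 0, (g : Matrix (Fin 2) (Fin 2) ℂ) 0 1, 0;
     (g : Matrix (Fin 2) (Fin 2) ℂ) 1 0, (g : Matrix (Fin 2) (Fin 2) ℂ) 1 1, 0;
     0, 0, 1]

/-- The invariant `I₄ = h₁y₂y₃ + y₁y₂² − x₁y₃²`. -/
def I₄ (A : Matrix (Fin 3) (Fin 3) ℂ) : ℂ :=
  (A 0 0 - A 1 1) * A 1 2 * A 0 2 + A 0 1 * A 1 2 ^ 2 - A 1 0 * A 0 2 ^ 2

/-- The inverse of `u g` is `u g⁻¹`. -/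
theorem u_inv (g : Matrix.SpecialLinearGroup (Fin 2) ℂ) : (u g)⁻¹ = u g⁻¹ := by
  have hdet := g.det_coe
  rw [Matrix.det_fin_two] at hdet
  refine Matrix.inv_eq_right_inv ?_
  rw [Matrix.SpecialLinearGroup.SL2_inv_expl]
  ext i j
  fin_cases i <;> fin_cases j <;> simp [u, Matrix.mul_apply, Fin.sum_univ_three] <;>
    grind

/-- `I₄` is invariant under the adjoint action of the embedded `SL(2,ℂ)` on `sl(3,ℂ)`. -/
theorem I4_invariant (g : Matrix.SpecialLinearGroup (Fin 2) ℂ)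
    (A : Matrix (Fin 3) (Fin 3) ℂ) (hA : A.trace = 0) :
    I₄ (u g * A * (u g)⁻¹) = I₄ A := by
  have hdet := g.det_coe
  rw [Matrix.det_fin_two] at hdet
  rw [u_inv, Matrix.SpecialLinearGroup.SL2_inv_expl]
  simp only [I₄, u, Matrix.mul_apply, Fin.sum_univ_three, Matrix.of_apply, Matrix.cons_val]
  linear_combination (g 0 0 * g 1 1 - g 0 1 * g 1 0 + 1) *
    ((A 0 0 - A 1 1) * A 1 2 * A 0 2 + A 0 1 * A 1 2 ^ 2 - A 1 0 * A 0 2 ^ 2) * hdet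
end

section
/- Let V be the space of traceless 3×3 complex matrices, and call a function f : V → ℂ polynomial if it is given by a polynomial in the matrix entries. Define 𝔠₂(A) = 3(A₁₂A₂₁ + A₁₃A₃₁ + A₂₃A₃₂) + (A₁₁−A₂₂)² + (A₁₁−A₂₂)(A₂₂−A₃₃) + (A₂₂−A₃₃)² and 𝔠₃(A) = 27(A₂₁A₃₂A₁₃ + A₃₁A₁₂A₂₃) + 2(A₁₁−A₂₂)³ + 3(A₁₁−A₂₂)²(A₂₂−A₃₃) − 3(A₁₁−A₂₂)(A₂₂−A₃₃)² − 2(A₂₂−A₃₃)³ + 9[A₂₁A₁₂((A₁₁−A₂₂)+2(A₂₂−A₃₃)) − A₃₂A₂₃(2(A₁₁−A₂₂)+(A₂₂−A₃₃)) + A₃₁A₁₃((A₁₁−A₂₂)−(A₂₂−A₃₃))]. Then a polynomial function f : V → ℂ satisfies f(gAg⁻¹) = f(A) for all g ∈ SL(3,ℂ) and all A ∈ V if and only if f belongs to the ℂ-subalgebra of functions generated by 𝔠₂ and 𝔠₃. That is, {𝔠₂, 𝔠₃} is a fundamental system of invariants for the adjoint action of SL(3,ℂ) on sl(3,ℂ).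 -/
open Matrix

/-- The space `V = sl(3,ℂ)` of traceless `3×3` complex matrices. -/
abbrev sl3 : Type := {A : Matrix (Fin 3) (Fin 3) ℂ // A.trace = 0}

lemma trace_conj (g : Matrix.SpecialLinearGroup (Fin 3) ℂ) (A : sl3) :
    ((g : Matrix (Fin 3) (Fin 3) ℂ) * A.1 *
      ((g⁻¹ : Matrix.SpecialLinearGroup (Fin 3) ℂ) : Matrix (Fin 3) (Fin 3) ℂ)).trace = 0 := by
  rw [Matrix.trace_mul_cycle, ← Matrix.SpecialLinearGroup.coe_mul, inv_mul_cancel,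
    Matrix.SpecialLinearGroup.coe_one, Matrix.one_mul, A.2]

/-- The adjoint action of `SL(3,ℂ)` on `sl(3,ℂ)`. -/
noncomputable def conjAct (g : Matrix.SpecialLinearGroup (Fin 3) ℂ) (A : sl3) : sl3 :=
  ⟨(g : Matrix (Fin 3) (Fin 3) ℂ) * A.1 *
    ((g⁻¹ : Matrix.SpecialLinearGroup (Fin 3) ℂ) : Matrix (Fin 3) (Fin 3) ℂ), trace_conj g A⟩

/-- A function `V → ℂ` is polynomial if it is given by a polynomial in the matrix entries. -/
def IsPolyFun (f : sl3 → ℂ) : Prop :=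
  ∃ P : MvPolynomial (Fin 3 × Fin 3) ℂ,
    ∀ A : sl3, f A = MvPolynomial.eval (fun p => A.1 p.1 p.2) P

/-- The quadratic Casimir invariant `𝔠₂` as a function on `sl(3,ℂ)`. -/
noncomputable def c₂ : sl3 → ℂ := fun A =>
  3 * (A.1 0 1 * A.1 1 0 + A.1 0 2 * A.1 2 0 + A.1 1 2 * A.1 2 1) +
    (A.1 0 0 - A.1 1 1) ^ 2 + (A.1 0 0 - A.1 1 1) * (A.1 1 1 - A.1 2 2) +
    (A.1 1 1 - A.1 2 2) ^ 2

/-- The cubic Casimir invariant `𝔠₃` as a function on `sl(3,ℂ)`. -/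
noncomputable def c₃ : sl3 → ℂ := fun A =>
  27 * (A.1 1 0 * A.1 2 1 * A.1 0 2 + A.1 2 0 * A.1 0 1 * A.1 1 2) +
    2 * (A.1 0 0 - A.1 1 1) ^ 3 + 3 * (A.1 0 0 - A.1 1 1) ^ 2 * (A.1 1 1 - A.1 2 2) -
    3 * (A.1 0 0 - A.1 1 1) * (A.1 1 1 - A.1 2 2) ^ 2 - 2 * (A.1 1 1 - A.1 2 2) ^ 3 +
    9 * (A.1 1 0 * A.1 0 1 * ((A.1 0 0 - A.1 1 1) + 2 * (A.1 1 1 - A.1 2 2)) -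
         A.1 2 1 * A.1 1 2 * (2 * (A.1 0 0 - A.1 1 1) + (A.1 1 1 - A.1 2 2)) +
         A.1 2 0 * A.1 0 2 * ((A.1 0 0 - A.1 1 1) - (A.1 1 1 - A.1 2 2)))

lemma c₂_eq_trace (A : sl3) : c₂ A = 3 / 2 * (A.1 * A.1).trace := by
  obtain ⟨A, hA⟩ := A
  rw [trace_fin_three] at hA
  simp only [c₂, trace_fin_three, Matrix.mul_apply, Fin.sum_univ_three]
  rw [eq_neg_of_add_eq_zero_right hA]
  ring

lemma c₃_eq_det (A : sl3) : c₃ A = 27 * A.1.det := by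
  obtain ⟨A, hA⟩ := A
  rw [trace_fin_three] at hA
  simp only [c₃, det_fin_three]
  rw [eq_neg_of_add_eq_zero_right hA]
  ring

lemma c₂_conjAct (g : Matrix.SpecialLinearGroup (Fin 3) ℂ) (A : sl3) :
    c₂ (conjAct g A) = c₂ A := by
  have h : ((g⁻¹ : Matrix.SpecialLinearGroup (Fin 3) ℂ) : Matrix (Fin 3) (Fin 3) ℂ) * g.1 = 1 := by
    rw [← Matrix.SpecialLinearGroup.coe_mul, inv_mul_cancel, Matrix.SpecialLinearGroup.coe_one]
  have key : (conjAct g A).1 * (conjAct g A).1 = g.1 * (A.1 * A.1) *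
      ((g⁻¹ : Matrix.SpecialLinearGroup (Fin 3) ℂ) : Matrix (Fin 3) (Fin 3) ℂ) := by
    simp only [conjAct, Matrix.mul_assoc]
    rw [← Matrix.mul_assoc _ g.1, h, Matrix.one_mul]
  rw [c₂_eq_trace, c₂_eq_trace, key, Matrix.trace_mul_cycle, h, Matrix.one_mul]

lemma c₃_conjAct (g : Matrix.SpecialLinearGroup (Fin 3) ℂ) (A : sl3) :
    c₃ (conjAct g A) = c₃ A := by
  simp [c₃_eq_det, conjAct, -Matrix.SpecialLinearGroup.coe_inv]

/-- The algebra of polynomial functions on `sl(3,ℂ)`. -/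
noncomputable def polyFun : Subalgebra ℂ (sl3 → ℂ) :=
  (MvPolynomial.aeval (R := ℂ) fun (p : Fin 3 × Fin 3) (A : sl3) => A.1 p.1 p.2).range

lemma aeval_pi_apply {σ X : Type*} (x : σ → X → ℂ) (P : MvPolynomial σ ℂ) (A : X) :
    MvPolynomial.aeval x P A = MvPolynomial.eval (fun p => x p A) P := by
  induction P using MvPolynomial.induction_on with
  | C a => simp
  | add p q hp hq => simp [hp, hq]
  | mul_X p n hp => simp [hp]

lemma mem_polyFun {f : sl3 → ℂ} : f ∈ polyFun ↔ IsPolyFun f := by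
  simp only [polyFun, AlgHom.mem_range, IsPolyFun, funext_iff, aeval_pi_apply, eq_comm]

lemma entry_mem_polyFun (i j : Fin 3) : (fun A : sl3 => A.1 i j) ∈ polyFun :=
  ⟨MvPolynomial.X (i, j), by simp⟩

lemma c₂_mem_polyFun : c₂ ∈ polyFun := by
  have e := entry_mem_polyFun
  have h : c₂ = (3 / 2 : ℂ) • ∑ i, ∑ j, (fun A : sl3 => A.1 i j) * fun A : sl3 => A.1 j i := by
    funext A
    simp [c₂_eq_trace, Matrix.trace, Matrix.mul_apply]
  rw [h]
  exact polyFun.smul_mem (sum_mem fun i _ => sum_mem fun j _ => mul_mem (e i j) (e j i)) _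

lemma c₃_mem_polyFun : c₃ ∈ polyFun := by
  refine mem_polyFun.2 ⟨27 * (Matrix.of fun i j => MvPolynomial.X (i, j)).det, fun A => ?_⟩
  simp [c₃_eq_det, det_fin_three]

lemma adjoin_le_polyFun : Algebra.adjoin ℂ ({c₂, c₃} : Set (sl3 → ℂ)) ≤ polyFun := by
  refine Algebra.adjoin_le ?_
  rintro _ (rfl | rfl)
  exacts [c₂_mem_polyFun, c₃_mem_polyFun]

/-- The affine line through two traceless matrices. -/
def sl3Line (A B : sl3) (t : ℂ) : sl3 :=
  ⟨A.1 + t • (B.1 - A.1), by simp [A.2, B.2]⟩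

lemma exists_polynomial_on_line {f : sl3 → ℂ} (hf : f ∈ polyFun) (A B : sl3) :
    ∃ p : Polynomial ℂ, ∀ t, p.eval t = f (sl3Line A B t) := by
  obtain ⟨P, hP⟩ := mem_polyFun.1 hf
  refine ⟨MvPolynomial.aeval (fun p : Fin 3 × Fin 3 => Polynomial.C (A.1 p.1 p.2) +
    Polynomial.X * (Polynomial.C (B.1 p.1 p.2) - Polynomial.C (A.1 p.1 p.2))) P, fun t => ?_⟩
  rw [hP]
  clear hP
  induction P using MvPolynomial.induction_on with
  | C a => simp
  | add p q hp hq => simp [hp, hq]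
  | mul_X p n hp => rw [map_mul, map_mul, Polynomial.eval_mul, hp]; simp [sl3Line]

/-- A polynomial function vanishing off the zero locus of a nonzero one vanishes. -/
lemma eq_zero_of_mul_eq_zero_of_mem_polyFun {h d : sl3 → ℂ} (hh : h ∈ polyFun) (hd : d ∈ polyFun)
    (hhd : h * d = 0) {B : sl3} (hB : d B ≠ 0) : h = 0 := by
  funext A
  obtain ⟨p, hp⟩ := exists_polynomial_on_line hh A B
  obtain ⟨q, hq⟩ := exists_polynomial_on_line hd A B
  have hpq : p * q = 0 := Polynomial.funext fun t => by
    simpa [hp, hq] using congrFun hhd (sl3Line A B t)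
  rcases mul_eq_zero.1 hpq with rfl | rfl
  · simpa [sl3Line] using (hp 0).symm
  · exact absurd (by simpa [sl3Line] using (hq 1).symm) hB

/-- The companion matrix of the traceless characteristic polynomial with Casimirs `u` and `v`. -/
noncomputable def companion (u v : ℂ) : sl3 :=
  ⟨!![0, 0, v / 27; 1, 0, u / 3; 0, 1, 0], by simp [trace_fin_three]⟩

/-- The matrix with columns `e`, `A e`, `A² e`, for `e` the first standard basis vector. -/
def krylov (A : Matrix (Fin 3) (Fin 3) ℂ) : Matrix (Fin 3) (Fin 3) ℂ :=
  Matrix.of fun i => ![(1 : Matrix (Fin 3) (Fin 3) ℂ) i 0, A i 0, (A * A) i 0]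

lemma mul_krylov (A : sl3) :
    A.1 * krylov A.1 = krylov A.1 * (companion (c₂ A) (c₃ A)).1 := by
  obtain ⟨A, hA⟩ := A
  rw [trace_fin_three] at hA
  have h := eq_neg_of_add_eq_zero_right hA
  ext i j
  fin_cases i <;> fin_cases j <;>
    simp [krylov, companion, Matrix.mul_apply, Fin.sum_univ_three, c₂, c₃, h] <;> ring

lemma krylov_det_mem_polyFun : (fun A : sl3 => (krylov A.1).det) ∈ polyFun := by
  let M : Matrix (Fin 3) (Fin 3) (MvPolynomial (Fin 3 × Fin 3) ℂ) :=
    Matrix.of fun i j => MvPolynomial.X (i, j)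
  refine mem_polyFun.2 ⟨(Matrix.of fun i => ![(1 : Matrix (Fin 3) (Fin 3) _) i 0, M i 0,
    (M * M) i 0]).det, fun A => ?_⟩
  simp [krylov, M, det_fin_three, Matrix.mul_apply, Fin.sum_univ_three]

lemma krylov_companion_det : (krylov (companion 0 0).1).det = 1 := by
  simp [krylov, companion, det_fin_three, Matrix.mul_apply, Fin.sum_univ_three]

lemma exists_conjAct_companion (A : sl3) (hA : (krylov A.1).det ≠ 0) :
    ∃ g, conjAct g (companion (c₂ A) (c₃ A)) = A := by
  obtain ⟨z, hz⟩ := IsAlgClosed.exists_pow_nat_eq (krylov A.1).det⁻¹ (n := 3) (by norm_num)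
  let g : Matrix.SpecialLinearGroup (Fin 3) ℂ := ⟨z • krylov A.1, by
    rw [Matrix.det_smul, Fintype.card_fin, hz, inv_mul_cancel₀ hA]⟩
  refine ⟨g, Subtype.ext ?_⟩
  have h : g.1 * (companion (c₂ A) (c₃ A)).1 = A.1 * g.1 := by
    simp only [g, Matrix.smul_mul, Matrix.mul_smul, mul_krylov]
  simp only [conjAct]
  rw [h, Matrix.mul_assoc, ← Matrix.SpecialLinearGroup.coe_mul, mul_inv_cancel,
    Matrix.SpecialLinearGroup.coe_one, Matrix.mul_one]

lemma comp_companion_mem_adjoin {f : sl3 → ℂ} (hf : IsPolyFun f) :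
    (fun A => f (companion (c₂ A) (c₃ A))) ∈ Algebra.adjoin ℂ ({c₂, c₃} : Set (sl3 → ℂ)) := by
  obtain ⟨P, hP⟩ := hf
  set S := Algebra.adjoin ℂ ({c₂, c₃} : Set (sl3 → ℂ))
  have h₂ : c₂ ∈ S := Algebra.subset_adjoin (by simp)
  have h₃ : c₃ ∈ S := Algebra.subset_adjoin (by simp)
  let x : Fin 3 × Fin 3 → sl3 → ℂ := fun p A => (companion (c₂ A) (c₃ A)).1 p.1 p.2
  have hx : ∀ p, x p ∈ S := by
    have h₂' : (fun A => c₂ A / 3) ∈ S := by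
      convert S.smul_mem h₂ (1 / 3) using 1
      funext A; simp; ring
    have h₃' : (fun A => c₃ A / 27) ∈ S := by
      convert S.smul_mem h₃ (1 / 27) using 1
      funext A; simp; ring
    rintro ⟨i, j⟩
    fin_cases i <;> fin_cases j
    exacts [S.zero_mem, S.zero_mem, h₃', S.one_mem, S.zero_mem, h₂', S.zero_mem, S.one_mem,
      S.zero_mem]
  have h : (fun A => f (companion (c₂ A) (c₃ A))) = MvPolynomial.aeval x P := by
    funext A
    rw [hP, aeval_pi_apply]
  rw [h]
  have hle : (MvPolynomial.aeval (R := ℂ) x).range ≤ S := by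
    rw [← Algebra.adjoin_range_eq_range_aeval]
    exact Algebra.adjoin_le (Set.range_subset_iff.2 hx)
  exact hle ⟨P, rfl⟩

/-- `{𝔠₂, 𝔠₃}` is a fundamental system of invariants for the adjoint action of `SL(3,ℂ)`
on `sl(3,ℂ)`: a polynomial function is invariant iff it lies in the subalgebra of
functions generated by `𝔠₂` and `𝔠₃`. -/
theorem sl3_fundamental_invariants (f : sl3 → ℂ) (hf : IsPolyFun f) :
    (∀ (g : Matrix.SpecialLinearGroup (Fin 3) ℂ) (A : sl3), f (conjAct g A) = f A) ↔
      f ∈ Algebra.adjoin ℂ ({c₂, c₃} : Set (sl3 → ℂ)) := by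
  constructor
  · intro hinv
    have hF := comp_companion_mem_adjoin hf
    have hsub : f - (fun A => f (companion (c₂ A) (c₃ A))) = 0 := by
      refine eq_zero_of_mul_eq_zero_of_mem_polyFun
        (sub_mem (mem_polyFun.2 hf) (adjoin_le_polyFun hF)) krylov_det_mem_polyFun ?_
        (B := companion 0 0) (by simp [krylov_companion_det])
      funext A
      by_cases hA : (krylov A.1).det = 0
      · simp [hA]
      · obtain ⟨g, hg⟩ := exists_conjAct_companion A hA
        have h := hinv g (companion (c₂ A) (c₃ A))
        rw [hg] at h
        simp [h]
    rwa [sub_eq_zero.1 hsub]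
  · intro hmem g A
    clear hf
    induction hmem using Algebra.adjoin_induction with
    | mem x hx =>
      rcases hx with rfl | rfl
      exacts [c₂_conjAct g A, c₃_conjAct g A]
    | algebraMap r => rfl
    | add x y _ _ hx hy => simp [hx, hy]
    | mul x y _ _ hx hy => simp [hx, hy]
end
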